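/- For every integer k ≥ 1 one has w_{2k}(ℚ(√2)) = ∏_{ℓ} ℓ^{1 + v_ℓ(8k)}, the product being taken over all primes ℓ such that ℓ − 1 divides 2k; equivalently, w_{2k}(ℚ(√2)) = 2^{4 + v_2(k)} · ∏_{ℓ odd, (ℓ−1) ∣ 2k} ℓ^{1 + v_ℓ(k)}. -/

import Mathlib

open scoped Classical
noncomputable section

open Module

/-- The set of positive integers `m` such that the exponent of `Gal(F(μ_m)/F)` divides `j`. -/
def wSet (F : Type*) [Field F] (j : ℕ) : Set ℕ :=
  {m | 0 < m ∧ ∀ σ : AlgebraicClosure F ≃ₐ[F] AlgebraicClosure F,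
      ∀ ζ : AlgebraicClosure F, ζ ^ m = 1 → (σ ^ j) ζ = ζ}

/-- `w_j(F)`, the largest positive integer `m` such that `Gal(F(μ_m)/F)` has exponent
dividing `j`. -/
def w (F : Type*) [Field F] (j : ℕ) : ℕ := sSup (wSet F j)

lemma aux_repr (K : Type*) [Field K] [NumberField K]
    (hdeg : finrank ℚ K = 2) (x : K) (hx : x ^ 2 = 2) (y : K) :
    ∃ p q : ℚ, y = (p : K) + (q : K) * x := by
  have hli : LinearIndependent ℚ ![(1 : K), x] := by
    rw [LinearIndependent.pair_iff]
    intro s t h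
    have ht : t = 0 := by
      by_contra ht
      have h1 : (s : K) + t * x = 0 := by
        simpa [Algebra.smul_def] using h
      have h2 : ((s ^ 2 : ℚ) : K) = ((2 * t ^ 2 : ℚ) : K) := by
        push_cast
        have : (s : K) = - (t * x) := by linear_combination h1
        rw [this]
        linear_combination (t : K) ^ 2 * hx
      have h3 : s ^ 2 = 2 * t ^ 2 := by exact_mod_cast h2
      have h4 : (s / t) ^ 2 = 2 := by
        field_simp
        linarith
      have h5 : Irrational (√2) := irrational_sqrt_two
      have h6 : √2 = ((|s / t| : ℚ) : ℝ) := by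
        rw [Real.sqrt_eq_iff_mul_self_eq (by norm_num) (by positivity)]
        have : |s / t| * |s / t| = 2 := by rw [abs_mul_abs_self]; linarith
        exact_mod_cast this.symm
      exact h5 ⟨_, h6.symm⟩
    subst ht
    refine ⟨?_, rfl⟩
    simpa using h
  have hsp := hli.span_eq_top_of_card_eq_finrank' (by simp [hdeg])
  have hy : y ∈ Submodule.span ℚ (Set.range ![(1 : K), x]) := by rw [hsp]; trivial
  rw [Matrix.range_cons_cons_empty, Submodule.mem_span_pair] at hy
  obtain ⟨a, b, h⟩ := hy
  refine ⟨a, b, ?_⟩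
  rw [← h]
  simp [Algebra.smul_def]

lemma aux_z8 {L : Type*} [Field L] {z : L} (hz : IsPrimitiveRoot z 8) : z ^ 4 = -1 := by
  have h := hz.pow_eq_one
  have h4 : z ^ 4 ≠ 1 := hz.pow_ne_one_of_pos_of_lt (by norm_num) (by norm_num)
  have : (z ^ 4 - 1) * (z ^ 4 + 1) = 0 := by linear_combination h
  rcases mul_eq_zero.1 this with h | h
  · exact absurd (by linear_combination h) h4
  · linear_combination h

lemma aux_s2 {L : Type*} [Field L] {z : L} (hz : IsPrimitiveRoot z 8) :
    (z + z ^ 7) ^ 2 = 2 := by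
  have h := aux_z8 hz
  linear_combination (z ^ 10 - z ^ 6 + 2 * z ^ 4 + z ^ 2 - 2) * h

lemma aux_mod {L : Type*} [Field L] {z : L} (hz : z ^ 8 = 1) (a : ℕ) :
    z ^ a = z ^ (a % 8) := by
  conv_lhs => rw [← Nat.div_add_mod a 8, pow_add, pow_mul, hz, one_pow, one_mul]

lemma aux_exists (K : Type*) [Field K] [NumberField K]
    (hdeg : finrank ℚ K = 2) (hsqrt2 : ∃ x : K, x ^ 2 = 2) (m a : ℕ) (hm : 0 < m)
    (ha : a.Coprime (8 * m)) (ha8 : a % 8 = 1 ∨ a % 8 = 7)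
    (ζ : AlgebraicClosure K) (hζ : IsPrimitiveRoot ζ (8 * m)) :
    ∃ σ : AlgebraicClosure K ≃ₐ[K] AlgebraicClosure K, σ ζ = ζ ^ a := by
  obtain ⟨x, hx⟩ := hsqrt2
  have hcz : CharZero (AlgebraicClosure K) := inferInstance
  have : Algebra.IsAlgebraic ℚ (AlgebraicClosure K) :=
    Algebra.IsAlgebraic.trans ℚ K (AlgebraicClosure K)
  have : Normal ℚ (AlgebraicClosure K) :=
    normal_iff.2 fun x => ⟨(Algebra.IsAlgebraic.isAlgebraic x).isIntegral, IsAlgClosed.splits _⟩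
  have hpa : IsPrimitiveRoot (ζ ^ a) (8 * m) := hζ.pow_of_coprime a ha
  have hpos : 0 < 8 * m := by omega
  obtain ⟨σ, hσ⟩ := minpoly.exists_algEquiv_of_root' (K := ℚ) (x := ζ ^ a) (y := ζ)
    (Algebra.IsAlgebraic.isAlgebraic ζ) (by
      have h1 := Polynomial.cyclotomic_eq_minpoly_rat hζ hpos
      have h2 := Polynomial.cyclotomic_eq_minpoly_rat hpa hpos
      have h3 : minpoly ℚ ζ = minpoly ℚ (ζ ^ a) := by
        convert h1.symm.trans h2
      rw [h3]
      exact minpoly.aeval _ _)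
  have hz : IsPrimitiveRoot (ζ ^ m) 8 := hζ.pow hpos (mul_comm _ _)
  set z := ζ ^ m with hzdef
  have hσz : σ z = z ^ a := by
    rw [hzdef, map_pow, hσ, ← pow_mul, ← pow_mul, mul_comm]
  have hσs : σ (z + z ^ 7) = z + z ^ 7 := by
    have h8 := hz.pow_eq_one
    rw [map_add, map_pow σ z 7, hσz, aux_mod h8 a]
    rcases ha8 with h | h <;> rw [h]
    · ring
    · linear_combination (z ^ 41 + z ^ 33 + z ^ 25 + z ^ 17 + z ^ 9 + z) * h8
  have hs2 := aux_s2 hz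
  have hσx : σ (algebraMap K _ x) = algebraMap K _ x := by
    have hx2 : (algebraMap K (AlgebraicClosure K) x) ^ 2 = 2 := by
      rw [← map_pow, hx, map_ofNat]
    have : (algebraMap K (AlgebraicClosure K) x) ^ 2 = (z + z ^ 7) ^ 2 := by rw [hx2, hs2]
    rcases sq_eq_sq_iff_eq_or_eq_neg.1 this with h | h
    · rw [h, hσs]
    · rw [h, map_neg, hσs]
  refine ⟨AlgEquiv.ofRingEquiv (f := σ.toRingEquiv) ?_, hσ⟩
  intro y
  obtain ⟨p, q, rfl⟩ := aux_repr K hdeg x hx y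
  change σ _ = _
  simp only [map_add, map_mul, hσx, map_ratCast]

lemma aux_pow {F L : Type*} [Field F] [Field L] [Algebra F L] (σ : L ≃ₐ[F] L) (ζ : L) (a : ℕ)
    (h : σ ζ = ζ ^ a) (j : ℕ) : (σ ^ j) ζ = ζ ^ (a ^ j) := by
  induction j with
  | zero => simp
  | succ n ih =>
    rw [pow_succ, AlgEquiv.mul_apply, h, map_pow, ih, ← pow_mul, pow_succ]

lemma aux_A (K : Type*) [Field K] [NumberField K]
    (hdeg : finrank ℚ K = 2) (hsqrt2 : ∃ x : K, x ^ 2 = 2) (j m a : ℕ) (hm : m ∈ wSet K j)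
    (ha : a.Coprime (8 * m)) (ha8 : a % 8 = 1 ∨ a % 8 = 7) : a ^ j ≡ 1 [MOD m] := by
  obtain ⟨hm0, hm⟩ := hm
  have hpos : 0 < 8 * m := by omega
  have : NeZero (8 * m) := ⟨hpos.ne'⟩
  obtain ⟨ζ, hζ⟩ := HasEnoughRootsOfUnity.exists_primitiveRoot (AlgebraicClosure K) (8 * m)
  obtain ⟨σ, hσ⟩ := aux_exists K hdeg hsqrt2 m a hm0 ha ha8 ζ hζ
  have hη : IsPrimitiveRoot (ζ ^ 8) m := hζ.pow hpos rfl
  have h1 := hm σ (ζ ^ 8) hη.pow_eq_one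
  rw [map_pow, aux_pow σ ζ a hσ, ← pow_mul, mul_comm, pow_mul] at h1
  have h2 : (ζ ^ 8) ^ (a ^ j) = (ζ ^ 8) ^ 1 := by rw [h1, pow_one]
  rw [hη.eq_orderOf]
  have hfin : IsOfFinOrder (ζ ^ 8) := isOfFinOrder_iff_pow_eq_one.2 ⟨m, hm0, hη.pow_eq_one⟩
  exact hfin.pow_eq_pow_iff_modEq.1 h2

lemma aux_B (K : Type*) [Field K] [NumberField K]
    (hsqrt2 : ∃ x : K, x ^ 2 = 2) (j m : ℕ) (hm : 0 < m)
    (H : ∀ a : ℕ, a.Coprime (8 * m) → (a % 8 = 1 ∨ a % 8 = 7) → a ^ j ≡ 1 [MOD 8 * m]) :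
    8 * m ∈ wSet K j := by
  obtain ⟨x, hx⟩ := hsqrt2
  have hpos : 0 < 8 * m := by omega
  refine ⟨hpos, fun σ η hη => ?_⟩
  have : NeZero (8 * m) := ⟨hpos.ne'⟩
  obtain ⟨ζ, hζ⟩ := HasEnoughRootsOfUnity.exists_primitiveRoot (AlgebraicClosure K) (8 * m)
  have hσζ : IsPrimitiveRoot (σ ζ) (8 * m) := hζ.map_of_injective σ.injective
  obtain ⟨a, -, hac, ha⟩ := (hζ.isPrimitiveRoot_iff).1 hσζ
  have hz : IsPrimitiveRoot (ζ ^ m) 8 := hζ.pow hpos (mul_comm _ _)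
  set z := ζ ^ m with hzdef
  have h8 := hz.pow_eq_one
  have hσz : σ z = z ^ a := by
    rw [hzdef, map_pow, ← ha, ← pow_mul, ← pow_mul, mul_comm]
  have hs2 := aux_s2 hz
  have hσs : σ (z + z ^ 7) = z + z ^ 7 := by
    have hx2 : (algebraMap K (AlgebraicClosure K) x) ^ 2 = 2 := by
      rw [← map_pow, hx, map_ofNat]
    have : (z + z ^ 7) ^ 2 = (algebraMap K (AlgebraicClosure K) x) ^ 2 := by rw [hx2, hs2]
    rcases sq_eq_sq_iff_eq_or_eq_neg.1 this with h | h
    · rw [h, AlgEquiv.commutes]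
    · rw [h, map_neg, AlgEquiv.commutes]
  have hodd : a % 2 = 1 := by
    have : a.Coprime 2 := hac.coprime_dvd_right (by omega)
    exact Nat.odd_iff.1 ((Nat.coprime_two_right).1 this)
  have hz4 := aux_z8 hz
  have ha8 : a % 8 = 1 ∨ a % 8 = 7 := by
    by_contra hcon
    have h35 : a % 8 = 3 ∨ a % 8 = 5 := by omega
    rw [map_add, map_pow σ z 7, hσz, aux_mod h8 a] at hσs
    have hneg : z + z ^ 7 = - (z + z ^ 7) := by
      nth_rewrite 1 [← hσs]
      rcases h35 with h | h <;> rw [h]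
      · linear_combination (z ^ 3 + z + (z ^ 17 - z ^ 13 + z ^ 9 - z ^ 5)) * hz4
      · linear_combination (z ^ 3 + z + (z ^ 31 - z ^ 27 + z ^ 23 - z ^ 19 + z ^ 15 - z ^ 11 + z ^ 7 - z ^ 3)) * hz4
    have h0 : z + z ^ 7 = 0 := by
      have : (2 : AlgebraicClosure K) * (z + z ^ 7) = 0 := by linear_combination hneg
      simpa using this
    rw [h0] at hs2
    norm_num at hs2
  obtain ⟨i, -, rfl⟩ := hζ.eq_pow_of_pow_eq_one hη
  rw [map_pow, aux_pow σ ζ a ha.symm]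
  congr 1
  have h1 := H a hac ha8
  nth_rewrite 2 [← pow_one ζ]
  rw [hζ.eq_orderOf] at h1
  have hfin : IsOfFinOrder ζ := isOfFinOrder_iff_pow_eq_one.2 ⟨_, hpos, hζ.pow_eq_one⟩
  exact hfin.pow_eq_pow_iff_modEq.2 h1

lemma aux_two (a v : ℕ) (ha8 : a % 8 = 1 ∨ a % 8 = 7) :
    (2 : ℤ) ^ (4 + v) ∣ (a : ℤ) ^ (2 * 2 ^ v) - 1 := by
  induction v with
  | zero =>
    obtain ⟨b, hb⟩ : ∃ b : ℤ, (a : ℤ) = 8 * b + 1 ∨ (a : ℤ) = 8 * b + 7 :=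
      ⟨(a / 8 : ℕ), by omega⟩
    rcases hb with hb | hb <;> rw [hb]
    · exact ⟨4 * b ^ 2 + b, by ring⟩
    · exact ⟨4 * b ^ 2 + 7 * b + 3, by ring⟩
  | succ n ih =>
    have h2 : (2 : ℤ) ∣ (a : ℤ) ^ (2 * 2 ^ n) + 1 := by
      have h1 : (2 : ℤ) ∣ 2 ^ (4 + n) := dvd_pow_self 2 (by omega)
      have := h1.trans ih
      omega
    have h3 := mul_dvd_mul ih h2
    have e : (a : ℤ) ^ (2 * 2 ^ (n + 1)) - 1
        = ((a : ℤ) ^ (2 * 2 ^ n) - 1) * ((a : ℤ) ^ (2 * 2 ^ n) + 1) := by ring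
    rw [e]
    exact h3

lemma aux_v2 (k : ℕ) (hk : 1 ≤ k) : padicValNat 2 (8 * k) = 3 + padicValNat 2 k := by
  have : Fact (Nat.Prime 2) := ⟨Nat.prime_two⟩
  rw [padicValNat.mul (by norm_num) (by omega)]
  congr 1
  have : (8 : ℕ) = 2 ^ 3 := by norm_num
  rw [this, padicValNat.prime_pow]

lemma aux_vodd (ℓ k : ℕ) (hl : ℓ.Prime) (h2 : ℓ ≠ 2) (hk : 1 ≤ k) :
    padicValNat ℓ (8 * k) = padicValNat ℓ k := by
  have : Fact (Nat.Prime ℓ) := ⟨hl⟩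
  rw [padicValNat.mul (by norm_num) (by omega)]
  have : padicValNat ℓ 8 = 0 := by
    apply padicValNat.eq_zero_of_not_dvd
    intro h
    have h8 : (8 : ℕ) = 2 ^ 3 := by norm_num
    rw [h8] at h
    exact h2 ((Nat.prime_dvd_prime_iff_eq hl Nat.prime_two).1 (hl.dvd_of_dvd_pow h))
  omega

lemma aux_low (ℓ k a : ℕ) (hk : 1 ≤ k) (hl : ℓ.Prime) (hd : (ℓ - 1) ∣ 2 * k)
    (hc : a.Coprime ℓ) (ha8 : a % 8 = 1 ∨ a % 8 = 7) :
    ((ℓ : ℤ) ^ (1 + padicValNat ℓ (8 * k))) ∣ (a : ℤ) ^ (2 * k) - 1 := by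
  have hpv : ℓ ^ padicValNat ℓ k ∣ k := pow_padicValNat_dvd
  by_cases h2 : ℓ = 2
  · subst h2
    rw [aux_v2 k hk]
    have h := aux_two a (padicValNat 2 k) ha8
    obtain ⟨c, hc⟩ := hpv
    have h3 : (a : ℤ) ^ (2 * 2 ^ padicValNat 2 k) - 1 ∣ (a : ℤ) ^ (2 * k) - 1 := by
      have e : 2 * k = (2 * 2 ^ padicValNat 2 k) * c := by rw [mul_assoc, ← hc]
      rw [e, pow_mul _ _ c]
      simpa using sub_dvd_pow_sub_pow ((a : ℤ) ^ (2 * 2 ^ padicValNat 2 k)) 1 c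
    have e2 : 1 + (3 + padicValNat 2 k) = 4 + padicValNat 2 k := by ring
    rw [e2]
    exact_mod_cast h.trans h3
  · rw [aux_vodd ℓ k hl h2 hk]
    have h1 : a ^ Nat.totient (ℓ ^ (1 + padicValNat ℓ k)) ≡ 1 [MOD ℓ ^ (1 + padicValNat ℓ k)] :=
      Nat.ModEq.pow_totient (hc.pow_right _)
    have hdv : Nat.totient (ℓ ^ (1 + padicValNat ℓ k)) ∣ 2 * k := by
      rw [Nat.totient_prime_pow hl (by omega)]
      have hcop : Nat.Coprime (ℓ ^ (1 + padicValNat ℓ k - 1)) (ℓ - 1) := by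
        apply Nat.Coprime.pow_left
        have := hl.one_lt
        exact (Nat.coprime_self_sub_right (by omega)).2 (by simp)
      refine hcop.mul_dvd_of_dvd_of_dvd ?_ hd
      rw [Nat.add_sub_cancel_left]
      exact hpv.mul_left 2
    obtain ⟨c, hc⟩ := hdv
    have h4 : a ^ (2 * k) ≡ 1 [MOD ℓ ^ (1 + padicValNat ℓ k)] := by
      rw [hc, pow_mul]
      simpa using h1.pow c
    have h5 := (Nat.modEq_iff_dvd.1 h4.symm)
    push_cast at h5
    exact h5

lemma aux_up2 (k e : ℕ) (hk : 1 ≤ k) (h : 7 ^ (2 * k) ≡ 1 [MOD 2 ^ e]) :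
    e ≤ 4 + padicValNat 2 k := by
  have : Fact (Nat.Prime 2) := ⟨Nat.prime_two⟩
  have h1 : 2 ^ e ∣ 7 ^ (2 * k) - 1 :=
    (Nat.modEq_iff_dvd' (Nat.one_le_pow _ _ (by norm_num))).1 h.symm
  have hgt : 1 < 7 ^ (2 * k) := Nat.one_lt_pow (by omega) (by norm_num)
  have h2 := (padicValNat_dvd_iff_le (p := 2) (by omega : 7 ^ (2 * k) - 1 ≠ 0)).1 h1
  have h3 := padicValNat.pow_two_sub_pow (x := 7) (y := 1) (by norm_num) (by norm_num)
    (by norm_num) (n := 2 * k) (by omega) (by simp)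
  rw [one_pow] at h3
  have e1 : padicValNat 2 (7 + 1) = 3 := by
    have : (7 + 1 : ℕ) = 2 ^ 3 := by norm_num
    rw [this, padicValNat.prime_pow]
  have e2 : padicValNat 2 (7 - 1) = 1 := by
    have : (7 - 1 : ℕ) = 2 * 3 := by norm_num
    rw [this, padicValNat.mul (by norm_num) (by norm_num), padicValNat.self (by norm_num),
      padicValNat.eq_zero_of_not_dvd (by norm_num)]
  have e3 : padicValNat 2 (2 * k) = 1 + padicValNat 2 k := by
    rw [padicValNat.mul (by norm_num) (by omega), padicValNat.self (by norm_num)]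
  omega

lemma aux_upodd (ℓ k e : ℕ) (hk : 1 ≤ k) (hl : ℓ.Prime) (h2 : ℓ ≠ 2) (he : e ≠ 0)
    (h : ∀ a : ℕ, a.Coprime ℓ → a ^ (2 * k) ≡ 1 [MOD ℓ ^ e]) :
    (ℓ - 1) ∣ 2 * k ∧ e ≤ 1 + padicValNat ℓ k := by
  have : Fact (Nat.Prime ℓ) := ⟨hl⟩
  have : NeZero (ℓ ^ e) := ⟨pow_ne_zero _ hl.ne_zero⟩
  have hcyc : IsCyclic (ZMod (ℓ ^ e))ˣ := ZMod.isCyclic_units_of_prime_pow ℓ hl h2 e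
  obtain ⟨g, hg⟩ := IsCyclic.exists_generator (α := (ZMod (ℓ ^ e))ˣ)
  have hord := orderOf_eq_card_of_forall_mem_zpowers hg
  rw [Nat.card_eq_fintype_card, ZMod.card_units_eq_totient] at hord
  have hgk : g ^ (2 * k) = 1 := by
    have hc := ZMod.val_coe_unit_coprime g
    have h1 := h (g : ZMod (ℓ ^ e)).val (hc.coprime_dvd_right (dvd_pow_self _ he))
    rw [← ZMod.natCast_eq_natCast_iff] at h1
    push_cast at h1
    rw [ZMod.natCast_zmod_val] at h1
    ext
    push_cast
    exact h1
  have hdvd : Nat.totient (ℓ ^ e) ∣ 2 * k := hord ▸ orderOf_dvd_of_pow_eq_one hgk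
  rw [Nat.totient_prime_pow hl (by omega)] at hdvd
  refine ⟨(dvd_mul_left _ _).trans hdvd, ?_⟩
  have h3 : ℓ ^ (e - 1) ∣ 2 * k := (dvd_mul_right _ _).trans hdvd
  have h4 : ℓ ^ (e - 1) ∣ k := by
    refine Nat.Coprime.dvd_of_dvd_mul_left ?_ h3
    exact Nat.Coprime.pow_left _ ((Nat.coprime_primes hl Nat.prime_two).2 h2)
  have h5 := (padicValNat_dvd_iff_le (p := ℓ) (by omega : k ≠ 0)).1 h4
  omega

def auxS (k : ℕ) : Finset ℕ := (Finset.range (2 * k + 2)).filter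
  (fun ℓ => ℓ.Prime ∧ (ℓ - 1) ∣ 2 * k)

lemma mem_auxS (k ℓ : ℕ) (hk : 1 ≤ k) : ℓ ∈ auxS k ↔ ℓ.Prime ∧ (ℓ - 1) ∣ 2 * k := by
  rw [auxS, Finset.mem_filter, Finset.mem_range]
  refine ⟨fun h => h.2, fun h => ⟨?_, h⟩⟩
  have := Nat.le_of_dvd (by omega) h.2
  omega

lemma aux_main (K : Type*) [Field K] [NumberField K]
    (hdeg : finrank ℚ K = 2) (hsqrt2 : ∃ x : K, x ^ 2 = 2)
    (k : ℕ) (hk : 1 ≤ k) :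
    w K (2 * k) = ∏ ℓ ∈ auxS k, ℓ ^ (1 + padicValNat ℓ (8 * k)) := by
  set N := ∏ ℓ ∈ auxS k, ℓ ^ (1 + padicValNat ℓ (8 * k)) with hN
  have hdvdN : ∀ ℓ ∈ auxS k, ℓ ^ (1 + padicValNat ℓ (8 * k)) ∣ N := fun ℓ hl =>
    Finset.dvd_prod_of_mem (fun ℓ => ℓ ^ (1 + padicValNat ℓ (8 * k))) hl
  have hNpos : 0 < N := Finset.prod_pos fun ℓ hl =>
    pow_pos ((mem_auxS k ℓ hk).1 hl).1.pos _
  have h2S : 2 ∈ auxS k := (mem_auxS k 2 hk).2 ⟨Nat.prime_two, by simp⟩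
  apply IsGreatest.csSup_eq
  constructor
  · have h8 : 8 ∣ N := by
      refine Dvd.dvd.trans ?_ (hdvdN 2 h2S)
      rw [aux_v2 k hk]
      have : (8 : ℕ) = 2 ^ 3 := by norm_num
      rw [this]
      exact pow_dvd_pow 2 (by omega)
    obtain ⟨m, hm⟩ := h8
    rw [hm]
    apply aux_B K hsqrt2 _ m (by omega)
    intro a hac ha8
    rw [← hm] at hac ⊢
    refine Nat.ModEq.symm (Nat.modEq_iff_dvd.2 ?_)
    push_cast [hN]
    refine Finset.prod_dvd_of_coprime ?_ ?_
    · intro p hp q hq hpq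
      have hp' := ((mem_auxS k p hk).1 hp).1
      have hq' := ((mem_auxS k q hk).1 hq).1
      exact IsCoprime.pow (Nat.isCoprime_iff_coprime.2 ((Nat.coprime_primes hp' hq').2 hpq))
    · intro p hp
      obtain ⟨hp', hd⟩ := (mem_auxS k p hk).1 hp
      refine aux_low p k a hk hp' hd ?_ ha8
      exact hac.coprime_dvd_right ((dvd_pow_self p (by omega)).trans (hdvdN p hp))
  · intro m hm
    apply Nat.le_of_dvd hNpos
    rw [Nat.dvd_iff_prime_pow_dvd_dvd]
    intro p e hp hpe
    by_cases he : e = 0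
    · subst he; simp
    have hpm : p ^ e ∈ wSet K (2 * k) := by
      refine ⟨pow_pos hp.pos _, fun σ ζ hζ => hm.2 σ ζ ?_⟩
      obtain ⟨c, rfl⟩ := hpe
      rw [pow_mul, hζ, one_pow]
    by_cases h2 : p = 2
    · subst h2
      have h7 : Nat.Coprime 7 (8 * 2 ^ e) :=
        Nat.Coprime.mul_right (by norm_num) (Nat.Coprime.pow_right _ (by norm_num))
      have := aux_up2 k e hk (aux_A K hdeg hsqrt2 _ _ 7 hpm h7 (by norm_num))
      refine (pow_dvd_pow 2 ?_).trans (hdvdN 2 h2S)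
      rw [aux_v2 k hk]
      omega
    · obtain ⟨hd, hle⟩ := aux_upodd p k e hk hp h2 he (by
        intro a hac
        have hcop : Nat.Coprime 8 (p ^ e) := by
          have h8 : (8 : ℕ) = 2 ^ 3 := by norm_num
          rw [h8]
          exact Nat.Coprime.pow _ _ ((Nat.coprime_primes Nat.prime_two hp).2 (Ne.symm h2))
        obtain ⟨b, hb1, hb2⟩ := Nat.chineseRemainder hcop 1 a
        have hbc : b.Coprime (8 * p ^ e) := by
          refine Nat.Coprime.mul_right ?_ ?_
          · have := hb1.gcd_eq
            rw [Nat.Coprime, this]; norm_num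
          · have := hb2.gcd_eq
            rw [Nat.Coprime, this]
            exact hac.pow_right e
        have := aux_A K hdeg hsqrt2 _ _ b hpm hbc (Or.inl hb1)
        exact (hb2.symm.pow _).trans this)
      refine (pow_dvd_pow p ?_).trans (hdvdN p ((mem_auxS k p hk).2 ⟨hp, hd⟩))
      rw [aux_vodd p k hp h2 hk]
      exact hle

theorem w_of_Q_sqrt_two
    (K : Type*) [Field K] [NumberField K]
    (hdeg : finrank ℚ K = 2) (hsqrt2 : ∃ x : K, x ^ 2 = 2)
    (k : ℕ) (hk : 1 ≤ k) :
    (w K (2 * k) = ∏ᶠ (ℓ : ℕ) (_ : ℓ.Prime ∧ (ℓ - 1) ∣ 2 * k),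
        ℓ ^ (1 + padicValNat ℓ (8 * k))) ∧
    (w K (2 * k) = 2 ^ (4 + padicValNat 2 k) *
      ∏ᶠ (ℓ : ℕ) (_ : ℓ.Prime ∧ ℓ ≠ 2 ∧ (ℓ - 1) ∣ 2 * k),
        ℓ ^ (1 + padicValNat ℓ k)) := by
  have hmain := aux_main K hdeg hsqrt2 k hk
  have h2S : 2 ∈ auxS k := (mem_auxS k 2 hk).2 ⟨Nat.prime_two, by simp⟩
  constructor
  · rw [hmain]
    symm
    apply finprod_cond_eq_prod_of_cond_iff
    intro ℓ _
    exact (mem_auxS k ℓ hk).symm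
  · rw [hmain, ← Finset.mul_prod_erase _ _ h2S, aux_v2 k hk]
    congr 1
    · congr 1
      ring
    · rw [finprod_cond_eq_prod_of_cond_iff (fun ℓ : ℕ => ℓ ^ (1 + padicValNat ℓ k))
        (p := fun ℓ : ℕ => ℓ.Prime ∧ ℓ ≠ 2 ∧ (ℓ - 1) ∣ 2 * k) (t := (auxS k).erase 2)]
      · apply Finset.prod_congr rfl
        intro ℓ hl
        rw [Finset.mem_erase, mem_auxS k ℓ hk] at hl
        rw [aux_vodd ℓ k hl.2.1 hl.1 hk]
      · intro ℓ _
        rw [Finset.mem_erase, mem_auxS k ℓ hk]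
        tauto
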